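/- With the q-quadratic lattice and the operators D_x, S_x as in the context, for every complex polynomial f and every integer n ≥ 0 the following polynomial identity holds: D_x^n(S_x f) = α_n·S_x(D_x^n f) + γ_n·U₁·(D_x^{n+1} f), where α_n = (q^{n/2}+q^{-n/2})/2, γ_n = (q^{n/2}−q^{-n/2})/(q^{1/2}−q^{-1/2}), and U₁(z) = (α²−1)(z−𝔠₃). -/

import Mathlib

open Polynomial

noncomputable def qp (q : ℝ) (t : ℂ) : ℂ := Complex.exp (t * (Real.log q : ℂ))

noncomputable def alphaL (q : ℝ) : ℂ := (qp q (1/2) + qp q (-(1/2))) / 2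

noncomputable def alphaN (q : ℝ) (n : ℕ) : ℂ :=
  (qp q ((n : ℂ) / 2) + qp q (-((n : ℂ) / 2))) / 2

noncomputable def gammaN (q : ℝ) (n : ℕ) : ℂ :=
  (qp q ((n : ℂ) / 2) - qp q (-((n : ℂ) / 2))) / (qp q (1/2) - qp q (-(1/2)))

noncomputable def latX (q : ℝ) (c1 c2 c3 s : ℂ) : ℂ := c1 * qp q (-s) + c2 * qp q s + c3

noncomputable def U1L (q : ℝ) (c3 : ℂ) : Polynomial ℂ :=
  Polynomial.C (alphaL q ^ 2 - 1) * (Polynomial.X - Polynomial.C c3)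

noncomputable def U2L (q : ℝ) (c1 c2 c3 : ℂ) : Polynomial ℂ :=
  Polynomial.C (alphaL q ^ 2 - 1) *
    ((Polynomial.X - Polynomial.C c3) ^ 2 - Polynomial.C (4 * c1 * c2))

/-- The q-quadratic lattice in the multiplicative variable `y = q ^ s`. -/
noncomputable def lattice (c1 c2 c3 y : ℂ) : ℂ := c1 / y + c2 * y + c3

lemma qp_add (q : ℝ) (s t : ℂ) : qp q (s + t) = qp q s * qp q t := by
  simp only [qp, add_mul, Complex.exp_add]

lemma qp_neg (q : ℝ) (t : ℂ) : qp q (-t) = (qp q t)⁻¹ := by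
  simp only [qp, neg_mul, Complex.exp_neg]

lemma qp_ne_zero (q : ℝ) (t : ℂ) : qp q t ≠ 0 := Complex.exp_ne_zero _

lemma exists_qp_eq {q : ℝ} (hq : 0 < q) (hq1 : q ≠ 1) {y : ℂ} (hy : y ≠ 0) :
    ∃ s, qp q s = y := by
  have hl : (Real.log q : ℂ) ≠ 0 :=
    Complex.ofReal_ne_zero.mpr (Real.log_ne_zero_of_pos_of_ne_one hq hq1)
  exact ⟨Complex.log y / Real.log q, by rw [qp, div_mul_cancel₀ _ hl, Complex.exp_log hy]⟩

lemma qp_half_sq {q : ℝ} (hq : 0 < q) : qp q (1 / 2) ^ 2 = q := by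
  rw [sq, ← qp_add, add_halves, qp, one_mul, ← Complex.ofReal_exp, Real.exp_log hq]

lemma latX_eq_lattice (q : ℝ) (c1 c2 c3 s : ℂ) :
    latX q c1 c2 c3 s = lattice c1 c2 c3 (qp q s) := by
  rw [latX, lattice, qp_neg, div_eq_mul_inv]

lemma lattice_mul_sub_lattice_div {c1 c2 c3 p y : ℂ} (hp : p ≠ 0) (hy : y ≠ 0) :
    lattice c1 c2 c3 (y * p) - lattice c1 c2 c3 (y / p) =
      (p ^ 2 - 1) * (c2 * y ^ 2 - c1) / (p * y) := by
  unfold lattice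
  field_simp
  ring

lemma lattice_mul_sub_lattice_div_ne_zero {c1 c2 c3 p y : ℂ} (hp : p ≠ 0) (hp2 : p ^ 2 ≠ 1)
    (hy : y ≠ 0) (h : c2 * y ^ 2 ≠ c1) :
    lattice c1 c2 c3 (y * p) - lattice c1 c2 c3 (y / p) ≠ 0 := by
  rw [lattice_mul_sub_lattice_div hp hy]
  exact div_ne_zero (mul_ne_zero (sub_ne_zero.mpr hp2) (sub_ne_zero.mpr h)) (mul_ne_zero hp hy)

lemma exists_lattice_eq {c1 c2 : ℂ} (h1 : c1 ≠ 0) (h2 : c2 ≠ 0) (c3 z : ℂ) :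
    ∃ y, y ≠ 0 ∧ lattice c1 c2 c3 y = z := by
  obtain ⟨r, hr⟩ := IsAlgClosed.exists_pow_nat_eq (discrim c2 (c3 - z) c1) two_pos
  obtain ⟨y, hy⟩ := exists_quadratic_eq_zero (a := c2) (b := c3 - z) (c := c1) h2
    ⟨r, by rw [← hr, sq]⟩
  have hy0 : y ≠ 0 := by
    rintro rfl
    exact h1 (by simpa using hy)
  refine ⟨y, hy0, ?_⟩
  unfold lattice
  field_simp
  linear_combination hy

lemma finite_setOf_mul_sq_eq {a : ℂ} (ha : a ≠ 0) (b : ℂ) : {y : ℂ | a * y ^ 2 = b}.Finite := by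
  have h : (C a * X ^ 2 - C b : ℂ[X]) ≠ 0 := by
    intro h
    have h' := congrArg (fun f : ℂ[X] => f.coeff 2) h
    simp [ha] at h'
  refine (finite_setOfPred_isRoot h).subset fun y hy => ?_
  simpa [IsRoot, sub_eq_zero] using hy

/-- Polynomials agreeing along the lattice off a finite set of parameters are equal. -/
lemma eq_of_eval_lattice_eq {c1 c2 c3 : ℂ} (h1 : c1 ≠ 0) (h2 : c2 ≠ 0) {B : Set ℂ}
    (hB : B.Finite) {f g : ℂ[X]}
    (h : ∀ y, y ≠ 0 → y ∉ B →
      f.eval (lattice c1 c2 c3 y) = g.eval (lattice c1 c2 c3 y)) : f = g := by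
  refine eq_of_infinite_eval_eq f g
    ((hB.image (lattice c1 c2 c3)).infinite_compl.mono fun z hz => ?_)
  obtain ⟨y, hy, rfl⟩ := exists_lattice_eq h1 h2 c3 z
  exact h y hy fun hyB => hz ⟨y, hyB, rfl⟩

section Operators

variable {c1 c2 c3 p : ℂ} {Dx Sx : ℂ[X] → ℂ[X]}

lemma dividedDiff_average (h1 : c1 ≠ 0) (h2 : c2 ≠ 0) (hp : p ≠ 0) (hp2 : p ^ 2 ≠ 1)
    (hDx : ∀ (f : Polynomial ℂ) (y : ℂ), y ≠ 0 → c2 * y ^ 2 ≠ c1 →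
      (Dx f).eval (lattice c1 c2 c3 y) =
        (f.eval (lattice c1 c2 c3 (y * p)) - f.eval (lattice c1 c2 c3 (y / p))) /
          (lattice c1 c2 c3 (y * p) - lattice c1 c2 c3 (y / p)))
    (hSx : ∀ (f : Polynomial ℂ) (y : ℂ), y ≠ 0 →
      (Sx f).eval (lattice c1 c2 c3 y) =
        (f.eval (lattice c1 c2 c3 (y * p)) + f.eval (lattice c1 c2 c3 (y / p))) / 2)
    {a : ℂ} (ha : a = (p + p⁻¹) / 2) (f : ℂ[X]) :
    Dx (Sx f) = C a * Sx (Dx f) + C (a ^ 2 - 1) * (X - C c3) * Dx (Dx f) := by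
  refine eq_of_eval_lattice_eq (c3 := c3) h1 h2 (((finite_setOf_mul_sq_eq h2 c1).union
    (finite_setOf_mul_sq_eq (mul_ne_zero h2 (pow_ne_zero 2 hp)) c1)).union
    (finite_setOf_mul_sq_eq h2 (c1 * p ^ 2))) fun y hy hyB => ?_
  simp only [Set.mem_union, Set.mem_ofPred_eq, not_or] at hyB
  obtain ⟨⟨hb, hbp⟩, hbm⟩ := hyB
  have hyp : y * p ≠ 0 := mul_ne_zero hy hp
  have hym : y / p ≠ 0 := div_ne_zero hy hp
  have hbp' : c2 * (y * p) ^ 2 ≠ c1 := fun h => hbp (by linear_combination h)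
  have hbm' : c2 * (y / p) ^ 2 ≠ c1 := fun h => hbm (by
    rw [← h]
    field_simp)
  have n0 := lattice_mul_sub_lattice_div_ne_zero (c3 := c3) hp hp2 hy hb
  have np := lattice_mul_sub_lattice_div_ne_zero (c3 := c3) hp hp2 hyp hbp'
  have nm := lattice_mul_sub_lattice_div_ne_zero (c3 := c3) hp hp2 hym hbm'
  simp only [eval_add, eval_mul, eval_sub, eval_C, eval_X]
  rw [hDx _ y hy hb, hSx _ y hy, hDx _ y hy hb, hSx _ _ hyp, hSx _ _ hym,
    hDx _ _ hyp hbp', hDx _ _ hym hbm']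
  rw [mul_div_cancel_right₀ y hp] at np ⊢
  rw [div_mul_cancel₀ y hp] at nm ⊢
  have ep : lattice c1 c2 c3 (y * p * p) - lattice c1 c2 c3 y =
      a * (lattice c1 c2 c3 (y * p) - lattice c1 c2 c3 (y / p)) +
        2 * (a ^ 2 - 1) * (lattice c1 c2 c3 y - c3) := by
    rw [ha]
    unfold lattice
    field_simp
    ring
  have em : lattice c1 c2 c3 y - lattice c1 c2 c3 (y / p / p) =
      a * (lattice c1 c2 c3 (y * p) - lattice c1 c2 c3 (y / p)) -
        2 * (a ^ 2 - 1) * (lattice c1 c2 c3 y - c3) := by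
    rw [ha]
    unfold lattice
    field_simp
    ring
  generalize hdp : (f.eval (lattice c1 c2 c3 (y * p * p)) - f.eval (lattice c1 c2 c3 y)) /
    (lattice c1 c2 c3 (y * p * p) - lattice c1 c2 c3 y) = dp
  generalize hdm : (f.eval (lattice c1 c2 c3 y) - f.eval (lattice c1 c2 c3 (y / p / p))) /
    (lattice c1 c2 c3 y - lattice c1 c2 c3 (y / p / p)) = dm
  rw [div_eq_iff np, ep] at hdp
  rw [div_eq_iff nm, em] at hdm
  generalize lattice c1 c2 c3 (y * p) - lattice c1 c2 c3 (y / p) = w at *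
  generalize lattice c1 c2 c3 (y * p * p) = xp at *
  generalize lattice c1 c2 c3 (y / p / p) = xm at *
  field_simp
  linear_combination hdp + hdm

lemma dividedDiff_linear_combination (h1 : c1 ≠ 0) (h2 : c2 ≠ 0) (hp : p ≠ 0) (hp2 : p ^ 2 ≠ 1)
    (hDx : ∀ (f : Polynomial ℂ) (y : ℂ), y ≠ 0 → c2 * y ^ 2 ≠ c1 →
      (Dx f).eval (lattice c1 c2 c3 y) =
        (f.eval (lattice c1 c2 c3 (y * p)) - f.eval (lattice c1 c2 c3 (y / p))) /
          (lattice c1 c2 c3 (y * p) - lattice c1 c2 c3 (y / p)))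
    (hSx : ∀ (f : Polynomial ℂ) (y : ℂ), y ≠ 0 →
      (Sx f).eval (lattice c1 c2 c3 y) =
        (f.eval (lattice c1 c2 c3 (y * p)) + f.eval (lattice c1 c2 c3 (y / p))) / 2)
    {a : ℂ} (ha : a = (p + p⁻¹) / 2) (k l : ℂ) (g h : ℂ[X]) :
    Dx (C k * g + C l * (X - C c3) * h) =
      C k * Dx g + C l * (Sx h + C a * (X - C c3) * Dx h) := by
  refine eq_of_eval_lattice_eq (c3 := c3) h1 h2 (finite_setOf_mul_sq_eq h2 c1) fun y hy hb => ?_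
  have n0 := lattice_mul_sub_lattice_div_ne_zero (c3 := c3) hp hp2 hy hb
  simp only [eval_add, eval_mul, eval_sub, eval_C, eval_X]
  rw [hDx _ y hy hb, hDx _ y hy hb, hDx _ y hy hb, hSx _ y hy]
  simp only [eval_add, eval_mul, eval_sub, eval_C, eval_X]
  have e : (lattice c1 c2 c3 (y * p) - c3) + (lattice c1 c2 c3 (y / p) - c3) =
      2 * a * (lattice c1 c2 c3 y - c3) := by
    rw [ha]
    unfold lattice
    field_simp
    ring
  field_simp
  linear_combination l * (h.eval (lattice c1 c2 c3 (y * p)) -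
    h.eval (lattice c1 c2 c3 (y / p))) * e

end Operators

lemma qp_succ_half (q : ℝ) (n : ℕ) :
    qp q (((n + 1 : ℕ) : ℂ) / 2) = qp q ((n : ℂ) / 2) * qp q (1 / 2) := by
  rw [← qp_add]
  push_cast
  ring_nf

lemma alphaN_succ {q : ℝ} (h : qp q (1 / 2) ^ 2 ≠ 1) (n : ℕ) :
    alphaN q (n + 1) = alphaL q * alphaN q n + (alphaL q ^ 2 - 1) * gammaN q n := by
  have hp := qp_ne_zero q (1 / 2)
  have hn := qp_ne_zero q ((n : ℂ) / 2)
  simp only [alphaN, alphaL, gammaN, qp_neg, qp_succ_half]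
  generalize qp q (1 / 2) = p at *
  generalize qp q ((n : ℂ) / 2) = r at *
  have h' : p ^ 2 - 1 ≠ 0 := sub_ne_zero.mpr h
  field_simp
  ring

lemma gammaN_succ {q : ℝ} (h : qp q (1 / 2) ^ 2 ≠ 1) (n : ℕ) :
    gammaN q (n + 1) = alphaN q n + alphaL q * gammaN q n := by
  have hp := qp_ne_zero q (1 / 2)
  have hn := qp_ne_zero q ((n : ℂ) / 2)
  simp only [alphaN, alphaL, gammaN, qp_neg, qp_succ_half]
  generalize qp q (1 / 2) = p at *
  generalize qp q ((n : ℂ) / 2) = r at *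
  have h' : p ^ 2 - 1 ≠ 0 := sub_ne_zero.mpr h
  field_simp
  ring

theorem stmt_5 (q : ℝ) (hq : 0 < q) (hq1 : q ≠ 1) (c1 c2 c3 : ℂ) (hc : c1 * c2 ≠ 0)
    (Dx Sx : Polynomial ℂ → Polynomial ℂ)
    (hDx : ∀ (f : Polynomial ℂ) (s : ℂ),
      latX q c1 c2 c3 (s + 1/2) ≠ latX q c1 c2 c3 (s - 1/2) →
      (Dx f).eval (latX q c1 c2 c3 s) =
        (f.eval (latX q c1 c2 c3 (s + 1/2)) - f.eval (latX q c1 c2 c3 (s - 1/2))) /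
          (latX q c1 c2 c3 (s + 1/2) - latX q c1 c2 c3 (s - 1/2)))
    (hSx : ∀ (f : Polynomial ℂ) (s : ℂ),
      (Sx f).eval (latX q c1 c2 c3 s) =
        (f.eval (latX q c1 c2 c3 (s + 1/2)) + f.eval (latX q c1 c2 c3 (s - 1/2))) / 2)
    :
    ∀ (n : ℕ) (f : Polynomial ℂ),
      Dx^[n] (Sx f) =
        C (alphaN q n) * Sx (Dx^[n] f) + C (gammaN q n) * U1L q c3 * Dx^[n + 1] f := by
  have h1 : c1 ≠ 0 := left_ne_zero_of_mul hc
  have h2 : c2 ≠ 0 := right_ne_zero_of_mul hc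
  have hp := qp_ne_zero q (1 / 2)
  have hp2 : qp q (1 / 2) ^ 2 ≠ 1 := by
    rw [qp_half_sq hq]
    exact_mod_cast hq1
  have ha : alphaL q = (qp q (1 / 2) + (qp q (1 / 2))⁻¹) / 2 := by rw [alphaL, qp_neg]
  have hsub (s : ℂ) : qp q (s - 1 / 2) = qp q s / qp q (1 / 2) := by
    rw [sub_eq_add_neg, qp_add, qp_neg, ← div_eq_mul_inv]
  simp only [latX_eq_lattice, hsub, qp_add] at hDx hSx
  have hD (f : ℂ[X]) (y : ℂ) (hy : y ≠ 0) (hb : c2 * y ^ 2 ≠ c1) :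
      (Dx f).eval (lattice c1 c2 c3 y) =
        (f.eval (lattice c1 c2 c3 (y * qp q (1 / 2))) -
          f.eval (lattice c1 c2 c3 (y / qp q (1 / 2)))) /
          (lattice c1 c2 c3 (y * qp q (1 / 2)) - lattice c1 c2 c3 (y / qp q (1 / 2))) := by
    obtain ⟨s, rfl⟩ := exists_qp_eq hq hq1 hy
    exact hDx f s (sub_ne_zero.mp (lattice_mul_sub_lattice_div_ne_zero hp hp2 hy hb))
  have hS (f : ℂ[X]) (y : ℂ) (hy : y ≠ 0) :
      (Sx f).eval (lattice c1 c2 c3 y) =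
        (f.eval (lattice c1 c2 c3 (y * qp q (1 / 2))) +
          f.eval (lattice c1 c2 c3 (y / qp q (1 / 2)))) / 2 := by
    obtain ⟨s, rfl⟩ := exists_qp_eq hq hq1 hy
    exact hSx f s
  intro n f
  induction n with
  | zero => simp [alphaN, gammaN, qp]
  | succ n ih =>
    have hU : C (gammaN q n) * U1L q c3 =
        C (gammaN q n * (alphaL q ^ 2 - 1)) * (X - C c3) := by
      rw [U1L, C_mul, mul_assoc]
    rw [Function.iterate_succ_apply' Dx n (Sx f), ih, hU,
      dividedDiff_linear_combination h1 h2 hp hp2 hD hS ha,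
      dividedDiff_average h1 h2 hp hp2 hD hS ha, alphaN_succ hp2, gammaN_succ hp2, U1L]
    simp only [Function.iterate_succ_apply', C_mul, C_add]
    ring
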